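/- arXiv:1109.6064 — 2 statements merged into one kernel-verified Lean document; each statement's English description precedes it below -/
import Mathlib

section
/- In a finite game, for every coarse correlated equilibrium x and every family y of nonnegative reals y^p_j ≥ 0, the expected social welfare of x is at most the maximum coarse deviation-adjusted social welfare: Σ_{s∈S} x_s w_s ≤ max_{s∈S} w̃_s(y). -/
open Finset

noncomputable section

variable {N : Type} [Fintype N] [DecidableEq N]
variable {S : N → Type} [∀ p, Fintype (S p)] [∀ p, DecidableEq (S p)]

/-- Social welfare of a pure strategy profile: the sum of the players' utilities. -/
def socialWelfare (u : (p : N) → ((q : N) → S q) → ℝ) (s : (q : N) → S q) : ℝ :=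
  ∑ p, u p s

/-- A correlated distribution: a nonnegative function on pure profiles summing to one. -/
def IsCorrDist (x : ((q : N) → S q) → ℝ) : Prop :=
  (∀ s, 0 ≤ x s) ∧ ∑ s, x s = 1

/-- A correlated equilibrium. -/
def IsCE (u : (p : N) → ((q : N) → S q) → ℝ) (x : ((q : N) → S q) → ℝ) : Prop :=
  IsCorrDist x ∧ ∀ (p : N) (i j : S p),
    0 ≤ ∑ s ∈ Finset.univ.filter (fun s : (q : N) → S q => s p = i),
          (u p s - u p (Function.update s p j)) * x s

/-- A coarse correlated equilibrium. -/
def IsCCE (u : (p : N) → ((q : N) → S q) → ℝ) (x : ((q : N) → S q) → ℝ) : Prop :=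
  IsCorrDist x ∧ ∀ (p : N) (j : S p),
    0 ≤ ∑ s : (q : N) → S q, (u p s - u p (Function.update s p j)) * x s

/-- Deviation-adjusted utility of player `p` at profile `s`, given multipliers `y`. -/
def devAdjU (u : (p : N) → ((q : N) → S q) → ℝ) (y : (p : N) → S p → S p → ℝ)
    (p : N) (s : (q : N) → S q) : ℝ :=
  u p s + ∑ j : S p, y p (s p) j * (u p s - u p (Function.update s p j))

/-- Deviation-adjusted social welfare. -/
def devAdjSW (u : (p : N) → ((q : N) → S q) → ℝ) (y : (p : N) → S p → S p → ℝ)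
    (s : (q : N) → S q) : ℝ :=
  ∑ p, devAdjU u y p s

/-- Coarse deviation-adjusted utility of player `p` at profile `s`. -/
def cDevAdjU (u : (p : N) → ((q : N) → S q) → ℝ) (y : (p : N) → S p → ℝ)
    (p : N) (s : (q : N) → S q) : ℝ :=
  u p s + ∑ j : S p, y p j * (u p s - u p (Function.update s p j))

/-- Coarse deviation-adjusted social welfare. -/
def cDevAdjSW (u : (p : N) → ((q : N) → S q) → ℝ) (y : (p : N) → S p → ℝ)
    (s : (q : N) → S q) : ℝ :=
  ∑ p, cDevAdjU u y p s

/-- Weighted deviation-adjusted utility of player `p` at profile `s`. -/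
def wDevAdjU (u : (p : N) → ((q : N) → S q) → ℝ) (y : (p : N) → S p → S p → ℝ)
    (v : N → ℝ) (p : N) (s : (q : N) → S q) : ℝ :=
  v p * u p s + ∑ j : S p, y p (s p) j * (u p s - u p (Function.update s p j))

/-- Weighted deviation-adjusted social welfare. -/
def wDevAdjSW (u : (p : N) → ((q : N) → S q) → ℝ) (y : (p : N) → S p → S p → ℝ)
    (v : N → ℝ) (s : (q : N) → S q) : ℝ :=
  ∑ p, wDevAdjU u y v p s

/-- Number of players choosing action `α` under profile `s`. -/
def count {N A : Type} [Fintype N] [DecidableEq A] (s : N → A) (α : A) : ℕ :=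
  (Finset.univ.filter (fun p => s p = α)).card

/-- The expected social welfare of a coarse correlated equilibrium is at most its expected coarse
deviation-adjusted social welfare. -/
theorem IsCCE.sum_mul_socialWelfare_le
    {u : (p : N) → ((q : N) → S q) → ℝ} {x : ((q : N) → S q) → ℝ}
    {y : (p : N) → S p → ℝ}
    (hx : IsCCE u x) (hy : ∀ (p : N) (j : S p), 0 ≤ y p j) :
    ∑ s, x s * socialWelfare u s ≤ ∑ s, x s * cDevAdjSW u y s := by
  have regret_nonneg : 0 ≤ ∑ p, ∑ j, y p j *
      ∑ s : (q : N) → S q, (u p s - u p (Function.update s p j)) * x s :=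
    Finset.sum_nonneg fun p _ => Finset.sum_nonneg fun j _ => mul_nonneg (hy p j) (hx.2 p j)
  have sum_eq : ∑ s, x s * cDevAdjSW u y s = ∑ s, x s * socialWelfare u s +
      ∑ p, ∑ j, y p j *
        ∑ s : (q : N) → S q, (u p s - u p (Function.update s p j)) * x s := by
    simp only [cDevAdjSW, cDevAdjU, socialWelfare, Finset.sum_add_distrib, mul_add,
      Finset.mul_sum]
    congr 1
    rw [Finset.sum_comm]
    refine Finset.sum_congr rfl fun p _ => ?_
    rw [Finset.sum_comm]
    exact Finset.sum_congr rfl fun j _ => Finset.sum_congr rfl fun s _ => by ring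
  linarith

/-- An expectation over profiles is at most the maximum over profiles. -/
theorem IsCorrDist.sum_mul_le_sup' [∀ p, Nonempty (S p)]
    {x : ((q : N) → S q) → ℝ} (hx : IsCorrDist x) (f : ((q : N) → S q) → ℝ) :
    ∑ s, x s * f s ≤ Finset.univ.sup' Finset.univ_nonempty f := by
  calc ∑ s, x s * f s
      ≤ ∑ s, x s * Finset.univ.sup' Finset.univ_nonempty f :=
        Finset.sum_le_sum fun s _ =>
          mul_le_mul_of_nonneg_left (Finset.le_sup' f (Finset.mem_univ s)) (hx.1 s)
    _ = Finset.univ.sup' Finset.univ_nonempty f := by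
        rw [← Finset.sum_mul, hx.2, one_mul]

/-- weak duality for CCE: the expected social welfare of any coarse
correlated equilibrium is at most the maximum coarse deviation-adjusted social
welfare, for any nonnegative multipliers `y`. -/
theorem cce_welfare_le_max_cDevAdjSW [∀ p, Nonempty (S p)]
    (u : (p : N) → ((q : N) → S q) → ℝ) (x : ((q : N) → S q) → ℝ)
    (y : (p : N) → S p → ℝ)
    (hx : IsCCE u x) (hy : ∀ (p : N) (j : S p), 0 ≤ y p j) :
    ∑ s, x s * socialWelfare u s ≤
      Finset.univ.sup' Finset.univ_nonempty
        (fun s : (q : N) → S q => cDevAdjSW u y s) := by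
  exact (hx.sum_mul_socialWelfare_le hy).trans (hx.1.sum_mul_le_sup' _)
end
end

section
/- In a singleton congestion game with players identified with ℤ/nℤ, averaging the CCE constraint coefficients over cyclic shifts yields a player-symmetric quantity: for i ∈ {0,…,n−1} let π_i be the permutation p ↦ p + i of the players and let s^{π_i} be the profile with (s^{π_i})_q = s_{π_i(q)}. Then for every profile s, every player p, and every action j ∈ A, Σ_{i=0}^{n−1} ( u^p_{s^{π_i}} − u^p_{(j, (s^{π_i})_{-p})} ) = Σ_{α∈A, α≠j} c_s(α) · f^α(c_s(α)) − (n − c_s(j)) · f^j(c_s(j) + 1); in particular, the left-hand side does not depend on the player p. -/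
open Finset

noncomputable section

variable {N : Type} [Fintype N] [DecidableEq N]
variable {S : N → Type} [∀ p, Fintype (S p)] [∀ p, DecidableEq (S p)]

theorem count_comp_equiv {M N A : Type} [Fintype M] [Fintype N] [DecidableEq A]
    (s : N → A) (e : M ≃ N) (α : A) : count (fun q => s (e q)) α = count s α := by
  unfold count
  exact Finset.card_equiv e (by simp)

theorem count_update_of_ne {N A : Type} [Fintype N] [DecidableEq N] [DecidableEq A]
    (s : N → A) {p : N} {j : A} (h : s p ≠ j) :
    count (Function.update s p j) j = count s j + 1 := by
  unfold count
  have hp : p ∉ Finset.univ.filter (fun q => s q = j) := by simp [h]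
  rw [← Finset.card_insert_of_notMem hp]
  congr 1
  ext q
  by_cases hq : q = p <;> simp [Function.update_apply, hq]

theorem sum_count_mul {N A : Type} [Fintype N] [Fintype A] [DecidableEq A]
    (s : N → A) (g : A → ℝ) : ∑ q, g (s q) = ∑ α, (count s α : ℝ) * g α := by
  rw [← Finset.sum_fiberwise Finset.univ s]
  refine Finset.sum_congr rfl fun α _ => ?_
  rw [Finset.sum_congr rfl (g := fun _ => g α) (fun q hq => by simp_all)]
  simp [count]

theorem sum_count {N A : Type} [Fintype N] [Fintype A] [DecidableEq A] (s : N → A) :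
    ∑ α, (count s α : ℝ) = Fintype.card N := by
  simpa using (sum_count_mul s (fun _ => 1)).symm

theorem sum_range_natCast_zmod {n : ℕ} [NeZero n] (h : ZMod n → ℝ) :
    ∑ i ∈ Finset.range n, h (i : ZMod n) = ∑ q, h q := by
  refine Finset.sum_bij' (fun i _ => (i : ZMod n)) (fun q _ => q.val) ?_ ?_ ?_ ?_ ?_
  · simp
  · simp [ZMod.val_lt]
  · intro i hi
    exact ZMod.val_cast_of_lt (Finset.mem_range.mp hi)
  · simp
  · simp

/-- in a singleton congestion game with players `ZMod n`, averaging the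
CCE constraint coefficients over the cyclic shifts `π_i : p ↦ p + i` yields a
player-symmetric quantity. -/
theorem singleton_congestion_cyclic_symmetrization {n : ℕ} [NeZero n]
    {A : Type} [Fintype A] [DecidableEq A]
    (f : A → ℕ → ℝ)
    (u : ZMod n → (ZMod n → A) → ℝ)
    (hu : ∀ (p : ZMod n) (s : ZMod n → A), u p s = f (s p) (count s (s p)))
    (s : ZMod n → A) (p : ZMod n) (j : A) :
    ∑ i ∈ Finset.range n,
        (u p (fun q => s (q + (i : ZMod n))) -
          u p (Function.update (fun q => s (q + (i : ZMod n))) p j)) =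
      ∑ α ∈ Finset.univ \ {j}, (count s α : ℝ) * f α (count s α) -
        ((n : ℝ) - (count s j : ℝ)) * f j (count s j + 1) := by
  have hterm (i : ZMod n) :
      u p (fun q => s (q + i)) - u p (Function.update (fun q => s (q + i)) p j) =
        if s (p + i) = j then 0
        else f (s (p + i)) (count s (s (p + i))) - f j (count s j + 1) := by
    split_ifs with h
    · rw [← h, Function.update_eq_self p (fun q => s (q + i)), sub_self]
    · have hc (α : A) : count (fun q => s (q + i)) α = count s α :=
        count_comp_equiv s (Equiv.addRight i) α
      rw [hu, hu, Function.update_self, count_update_of_ne (fun q => s (q + i)) h, hc, hc]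
  rw [Finset.sum_congr rfl fun (i : ℕ) _ => hterm i,
    sum_range_natCast_zmod (fun i => if s (p + i) = j then 0
      else f (s (p + i)) (count s (s (p + i))) - f j (count s j + 1))]
  refine (Equiv.sum_comp (Equiv.addLeft p) (fun q => if s q = j then 0
    else f (s q) (count s (s q)) - f j (count s j + 1))).trans ?_
  rw [sum_count_mul s (fun α => if α = j then 0 else f α (count s α) - f j (count s j + 1)),
    ← Finset.sum_sdiff (Finset.subset_univ {j}), Finset.sum_singleton, if_pos rfl,
    mul_zero, add_zero]
  have hn : (n : ℝ) - count s j = ∑ α ∈ Finset.univ \ {j}, (count s α : ℝ) := by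
    have hsum := sum_count s
    rw [ZMod.card, ← Finset.sum_sdiff (Finset.subset_univ {j}), Finset.sum_singleton] at hsum
    linarith
  rw [hn, Finset.sum_mul, ← Finset.sum_sub_distrib]
  refine Finset.sum_congr rfl fun α hα => ?_
  have hne : α ≠ j := by simpa using hα
  rw [if_neg hne, mul_sub]
end
end
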